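/- arXiv:1511.04264 — 2 statements merged into one kernel-verified Lean document; each statement's English description precedes it below -/
import Mathlib

section
/- For every fixed integer p ≥ 1, lim_{n→∞} T(n,p)·n^{5/2}·(12√3)^{−n} = C(p); in other words T(n,p) is asymptotically equivalent to C(p)·(12√3)^n·n^{−5/2} as n → ∞. -/
/-- The number of rooted type I triangulations of the p-gon with n inner vertices:
T(n,p) = 4^{n−1}·p·(2p)!·(2p+3n−5)!! / ((p!)²·n!·(2p+n−1)!!). -/
noncomputable def Tfun (n p : ℕ) : ℝ :=
  4 ^ (n - 1) * p * (Nat.factorial (2 * p) : ℝ) *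
      (Nat.doubleFactorial (2 * p + 3 * n - 5) : ℝ) /
    (((Nat.factorial p : ℝ)) ^ 2 * (Nat.factorial n : ℝ) *
      (Nat.doubleFactorial (2 * p + n - 1) : ℝ))

/-- The constant C(p) = 3^{p−2}·p·(2p)! / (4·√(2π)·(p!)²). -/
noncomputable def Cfun (p : ℕ) : ℝ :=
  (3 : ℝ) ^ ((p : ℤ) - 2) * p * (Nat.factorial (2 * p) : ℝ) /
    (4 * Real.sqrt (2 * Real.pi) * ((Nat.factorial p : ℝ)) ^ 2)

open Filter Topology in
lemma tendsto_even_odd {u : ℕ → ℝ} {a : ℝ} (he : Tendsto (fun k => u (2 * k)) atTop (𝓝 a))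
    (ho : Tendsto (fun k => u (2 * k + 1)) atTop (𝓝 a)) : Tendsto u atTop (𝓝 a) := by
  rw [Metric.tendsto_atTop] at *
  intro ε hε
  obtain ⟨N, hN⟩ := he ε hε
  obtain ⟨M, hM⟩ := ho ε hε
  refine ⟨2 * N + 2 * M + 1, fun n hn => ?_⟩
  rcases Nat.even_or_odd' n with ⟨k, rfl | rfl⟩
  · exact hN k (by omega)
  · exact hM k (by omega)

lemma fact_stirling (c k : ℕ) (hc : 0 < c) (hk : 0 < k) :
    ((c * k).factorial : ℝ) = Stirling.stirlingSeq (c * k) *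
      (√(2 * c) * √k * (((c : ℝ) ^ c) ^ k * (((k : ℝ) / Real.exp 1) ^ k) ^ c)) := by
  have hk' : (0 : ℝ) < k := by exact_mod_cast hk
  have hc' : (0 : ℝ) < c := by exact_mod_cast hc
  have h1 : √(2 * c) * √k = √(2 * ((c * k : ℕ) : ℝ)) := by
    rw [← Real.sqrt_mul (by positivity)]; push_cast; ring_nf
  have h2 : ((c : ℝ) ^ c) ^ k * (((k : ℝ) / Real.exp 1) ^ k) ^ c
      = (((c * k : ℕ) : ℝ) / Real.exp 1) ^ (c * k) := by
    rw [← pow_mul, ← pow_mul, mul_comm k c, ← mul_pow]; push_cast; ring_nf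
  rw [h1, h2, Stirling.stirlingSeq, div_mul_cancel₀]
  positivity

open Filter Topology in
lemma stirling_comp (c : ℕ) (hc : 0 < c) :
    Tendsto (fun k : ℕ => Stirling.stirlingSeq (c * k)) atTop (𝓝 √Real.pi) :=
  Stirling.tendsto_stirlingSeq_sqrt_pi.comp (tendsto_id.const_mul_atTop' hc)

lemma stirling_pos (k : ℕ) (hk : 0 < k) : 0 < Stirling.stirlingSeq k := by
  obtain ⟨j, rfl⟩ := Nat.exists_eq_succ_of_ne_zero hk.ne'
  exact Stirling.stirlingSeq'_pos j

open Filter Topology in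
lemma bracket_odd : Tendsto (fun k : ℕ => ((3 * k).factorial : ℝ) /
    (k.factorial * (2 * k).factorial) * (4 / 27) ^ k * √k) atTop (𝓝 (√3 / 2 / √Real.pi)) := by
  have hπ : √Real.pi ≠ 0 := by positivity
  have h := ((stirling_comp 3 (by norm_num)).div
    ((stirling_comp 1 (by norm_num)).mul (stirling_comp 2 (by norm_num)))
    (by positivity)).const_mul (√3 / 2)
  have e : √3 / 2 * (√Real.pi / (√Real.pi * √Real.pi)) = √3 / 2 / √Real.pi := by field_simp
  rw [e] at h
  refine h.congr' ?_
  filter_upwards [eventually_gt_atTop 0] with k hk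
  simp only [Pi.div_apply]
  have f1 := fact_stirling 1 k (by norm_num) hk
  have f2 := fact_stirling 2 k (by norm_num) hk
  have f3 := fact_stirling 3 k (by norm_num) hk
  have p1 := stirling_pos (1 * k) (by omega)
  have p2 := stirling_pos (2 * k) (by omega)
  have hk' : (0 : ℝ) < k := by exact_mod_cast hk
  have hD : (0 : ℝ) < ((k : ℝ) / Real.exp 1) ^ k := by positivity
  have hr : (0 : ℝ) < √k := by positivity
  have q : √(2 * (3 : ℕ)) = √2 * √(3 : ℝ) := by
    rw [← Real.sqrt_mul (by norm_num)]; norm_num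
  have q2 : √(2 * (2 : ℕ)) = 2 := by
    rw [show (2 : ℝ) * (2 : ℕ) = 2 ^ 2 by norm_num]; exact Real.sqrt_sq (by norm_num)
  have q1 : √(2 * (1 : ℕ)) = √2 := by norm_num
  rw [q1] at f1
  rw [q2] at f2
  rw [q] at f3
  rw [show k.factorial = (1 * k).factorial by rw [one_mul], f1, f2, f3]
  generalize Stirling.stirlingSeq (1 * k) = s1 at *
  generalize Stirling.stirlingSeq (2 * k) = s2 at *
  generalize Stirling.stirlingSeq (3 * k) = s3 at *
  generalize ((k : ℝ) / Real.exp 1) ^ k = D at *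
  generalize √(k : ℝ) = r at *
  norm_num
  rw [div_pow]
  field_simp

open Filter Topology in
lemma bracket_even : Tendsto (fun k : ℕ => ((6 * k).factorial : ℝ) * k.factorial /
    ((3 * k).factorial * (2 * k).factorial ^ 2) / 108 ^ k * √k) atTop
    (𝓝 (1 / 2 / √Real.pi)) := by
  have hπ : √Real.pi ≠ 0 := by positivity
  have h := (((stirling_comp 6 (by norm_num)).mul (stirling_comp 1 (by norm_num))).div
    ((stirling_comp 3 (by norm_num)).mul ((stirling_comp 2 (by norm_num)).pow 2))
    (by positivity)).const_mul (1 / 2)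
  have e : 1 / 2 * (√Real.pi * √Real.pi / (√Real.pi * √Real.pi ^ 2)) = 1 / 2 / √Real.pi := by
    field_simp
  rw [e] at h
  refine h.congr' ?_
  filter_upwards [eventually_gt_atTop 0] with k hk
  simp only [Pi.div_apply]
  have f1 := fact_stirling 1 k (by norm_num) hk
  have f2 := fact_stirling 2 k (by norm_num) hk
  have f3 := fact_stirling 3 k (by norm_num) hk
  have f6 := fact_stirling 6 k (by norm_num) hk
  have p1 := stirling_pos (3 * k) (by omega)
  have p2 := stirling_pos (2 * k) (by omega)
  have hk' : (0 : ℝ) < k := by exact_mod_cast hk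
  have hD : (0 : ℝ) < ((k : ℝ) / Real.exp 1) ^ k := by positivity
  have hr : (0 : ℝ) < √k := by positivity
  have q : √(2 * (3 : ℕ)) = √2 * √(3 : ℝ) := by
    rw [← Real.sqrt_mul (by norm_num)]; norm_num
  have q2 : √(2 * (2 : ℕ)) = 2 := by
    rw [show (2 : ℝ) * (2 : ℕ) = 2 ^ 2 by norm_num]; exact Real.sqrt_sq (by norm_num)
  have q1 : √(2 * (1 : ℕ)) = √2 := by norm_num
  have q6 : √(2 * (6 : ℕ)) = 2 * √3 := by
    rw [show (2 : ℝ) * (6 : ℕ) = 2 ^ 2 * 3 by norm_num, Real.sqrt_mul (by norm_num),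
      Real.sqrt_sq (by norm_num)]
  rw [q1] at f1
  rw [q2] at f2
  rw [q] at f3
  rw [q6] at f6
  rw [show k.factorial = (1 * k).factorial by rw [one_mul], f1, f2, f3, f6]
  generalize Stirling.stirlingSeq (1 * k) = s1 at *
  generalize Stirling.stirlingSeq (2 * k) = s2 at *
  generalize Stirling.stirlingSeq (3 * k) = s3 at *
  generalize Stirling.stirlingSeq (6 * k) = s6 at *
  generalize ((k : ℝ) / Real.exp 1) ^ k = D at *
  generalize √(k : ℝ) = r at *
  have e1 : ((6 : ℝ) ^ 6) ^ k = 108 ^ k * 27 ^ k * (4 ^ k) ^ 2 := by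
    rw [← pow_mul (4 : ℝ), mul_comm k 2, pow_mul, ← mul_pow, ← mul_pow]; norm_num
  norm_num at *
  rw [e1]
  field_simp
  try norm_num

/-- The case p = 1 (up to constants). -/
noncomputable def Gfun (n : ℕ) : ℝ :=
  4 ^ (n - 1) * (Nat.doubleFactorial (3 * n - 3) : ℝ) /
    (n.factorial * (Nat.doubleFactorial (n + 1) : ℝ)) * ((n : ℝ) ^ 2 * √n) / (12 * √3) ^ n

lemma sqrt3_pow (k : ℕ) : (12 * √3) ^ (2 * k) = (432 : ℝ) ^ k := by
  rw [pow_mul, mul_pow, Real.sq_sqrt (by norm_num)]; norm_num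

open Filter Topology in
lemma G_odd : Tendsto (fun k => Gfun (2 * k + 1)) atTop (𝓝 (1 / (12 * √(2 * Real.pi)))) := by
  have hinv := tendsto_inv_atTop_nhds_zero_nat (𝕜 := ℝ)
  have h2 : Tendsto (fun k : ℕ => (2 + (k : ℝ)⁻¹) / (2 * (1 + (k : ℝ)⁻¹)) *
      √(2 + (k : ℝ)⁻¹) / (12 * √3)) atTop
      (𝓝 ((2 + 0) / (2 * (1 + 0)) * √(2 + 0) / (12 * √3))) :=
    (((hinv.const_add 2).div ((hinv.const_add 1).const_mul 2) (by norm_num)).mul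
      ((hinv.const_add 2).sqrt)).div_const _
  have h := bracket_odd.mul h2
  have e : √3 / 2 / √Real.pi * ((2 + 0) / (2 * (1 + 0)) * √(2 + 0) / (12 * √3))
      = 1 / (12 * √(2 * Real.pi)) := by
    have hπ : 0 < √Real.pi := by positivity
    rw [Real.sqrt_mul (by norm_num)]
    norm_num
    field_simp
    norm_num
  rw [e] at h
  refine h.congr' ?_
  filter_upwards [eventually_gt_atTop 0] with k hk
  have hk' : (0 : ℝ) < k := by exact_mod_cast hk
  unfold Gfun
  rw [show 3 * (2 * k + 1) - 3 = 2 * (3 * k) by omega, show 2 * k + 1 + 1 = 2 * (k + 1) by ring,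
    Nat.doubleFactorial_two_mul, Nat.doubleFactorial_two_mul, pow_succ (12 * √3), sqrt3_pow,
    Nat.add_sub_cancel, pow_mul, pow_mul, Nat.factorial_succ, Nat.factorial_succ]
  have e2 : √(((2 * k + 1 : ℕ) : ℝ)) = √k * √(2 + (k : ℝ)⁻¹) := by
    rw [← Real.sqrt_mul (by positivity)]; congr 1; push_cast; field_simp
  rw [e2]
  push_cast
  have e3 : ((4 : ℝ) ^ 2) ^ k * (2 ^ 3) ^ k * 27 ^ k = 432 ^ k * 4 ^ k * 2 ^ k := by
    rw [← mul_pow, ← mul_pow, ← mul_pow, ← mul_pow]; norm_num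
  have f1 : (0 : ℝ) < k.factorial := by positivity
  have f2 : (0 : ℝ) < (2 * k).factorial := by positivity
  have e4 : ((4 : ℝ) ^ 2) ^ k * (2 ^ 3) ^ k = 432 ^ k * 4 ^ k * 2 ^ k / 27 ^ k := by
    rw [← e3]; field_simp
  have e5 : ∀ x : ℝ, ((4 : ℝ) ^ 2) ^ k * (8 ^ k * x) =
    432 ^ k * 4 ^ k * 2 ^ k / 27 ^ k * x := by intro x; rw [← mul_assoc, ← e4]; norm_num
  rw [e5, div_pow, pow_succ (2 : ℝ) k]
  generalize √(2 + (k : ℝ)⁻¹) = w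
  field_simp

open Filter Topology in
lemma G_even : Tendsto (fun k => Gfun (2 * k)) atTop (𝓝 (1 / (12 * √(2 * Real.pi)))) := by
  have hinv := tendsto_inv_atTop_nhds_zero_nat (𝕜 := ℝ)
  have h2 : Tendsto (fun k : ℕ => √2 / ((6 - (k : ℝ)⁻¹) * (2 + (k : ℝ)⁻¹))) atTop
      (𝓝 (√2 / ((6 - 0) * (2 + 0)))) :=
    tendsto_const_nhds.div ((hinv.const_sub 6).mul (hinv.const_add 2)) (by norm_num)
  have h := bracket_even.mul h2
  have e : 1 / 2 / √Real.pi * (√2 / ((6 - 0) * (2 + 0)))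
      = 1 / (12 * √(2 * Real.pi)) := by
    have hπ : 0 < √Real.pi := by positivity
    rw [Real.sqrt_mul (by norm_num)]
    norm_num
    field_simp
    norm_num
  rw [e] at h
  refine h.congr' ?_
  filter_upwards [eventually_gt_atTop 0] with k hk
  obtain ⟨j, rfl⟩ : ∃ j, k = j + 1 := ⟨k - 1, by omega⟩
  set k := j + 1 with hkj
  have hk1 : (1 : ℝ) ≤ k := by exact_mod_cast hk
  have hk' : (0 : ℝ) < k := by linarith
  have d1 : ((6 * k).factorial : ℝ) =
      (6 * k - 1) * (Nat.doubleFactorial (3 * (2 * k) - 3) : ℝ) * ((2 ^ 3) ^ k * (3 * k).factorial) := by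
    have a := Nat.factorial_eq_mul_doubleFactorial (6 * j + 5)
    rw [show 6 * j + 5 + 1 = 2 * (3 * k) by omega, Nat.doubleFactorial_two_mul,
      show 6 * j + 5 = (6 * j + 3) + 2 by omega, Nat.doubleFactorial_add_two] at a
    rw [show 6 * k = 2 * (3 * k) by omega, a, show 3 * (2 * k) - 3 = 6 * j + 3 by omega]
    push_cast [hkj]
    rw [pow_mul]
    ring
  have d2 : (2 ^ k * (k.factorial : ℝ)) * (Nat.doubleFactorial (2 * k + 1) : ℝ)
      = (2 * k + 1) * (2 * k).factorial := by
    have a := Nat.factorial_eq_mul_doubleFactorial (2 * k)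
    rw [Nat.doubleFactorial_two_mul, Nat.factorial_succ] at a
    have b : (((2 * k + 1) * (2 * k).factorial : ℕ) : ℝ) = _ := congrArg Nat.cast a
    push_cast at b
    linarith
  have d3 : (Nat.doubleFactorial (2 * k + 1) : ℝ)
      = (2 * k + 1) * (2 * k).factorial / (2 ^ k * (k.factorial : ℝ)) := by
    rw [← d2]; field_simp
  unfold Gfun
  rw [d1, d3, sqrt3_pow]
  have e2 : √(((2 * k : ℕ) : ℝ)) = √2 * √k := by
    rw [← Real.sqrt_mul (by positivity)]; push_cast; rfl
  have e6 : (4 : ℝ) ^ (2 * k - 1) = (4 ^ 2) ^ k / 4 := by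
    rw [← pow_mul, show 2 * k = (2 * k - 1) + 1 by omega, pow_succ, Nat.add_sub_cancel]; field_simp
  rw [e2, e6]
  have e3 : (432 : ℝ) ^ k = (4 ^ 2) ^ k * 2 ^ k * 108 ^ k / (2 ^ 3) ^ k := by
    rw [← mul_pow, ← mul_pow, ← div_pow]; norm_num
  rw [e3]
  have h6 : (6 * (k : ℝ) - 1) ≠ 0 := by nlinarith
  have h6' : (6 - (k : ℝ)⁻¹) = (6 * k - 1) / k := by field_simp
  have h7' : (2 + (k : ℝ)⁻¹) = (2 * k + 1) / k := by field_simp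
  have f1 : (0 : ℝ) < k.factorial := by positivity
  have f2 : (0 : ℝ) < (2 * k).factorial := by positivity
  have f3 : (0 : ℝ) < (3 * k).factorial := by positivity
  rw [h6', h7']
  push_cast
  generalize (6 * (k : ℝ) - 1) = w at *
  field_simp
  try norm_num

/-- Double factorial ratio. -/
noncomputable def Rfun (n p : ℕ) : ℝ :=
  4 ^ (n - 1) * (Nat.doubleFactorial (2 * p + 3 * n - 5) : ℝ) /
    (n.factorial * (Nat.doubleFactorial (2 * p + n - 1) : ℝ)) * ((n : ℝ) ^ 2 * √n) / (12 * √3) ^ n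

open Filter Topology in
lemma R_lim (p : ℕ) : Tendsto (fun n => Rfun n (p + 1)) atTop
    (𝓝 (3 ^ p * (1 / (12 * √(2 * Real.pi))))) := by
  induction p with
  | zero =>
    rw [pow_zero, one_mul]
    refine (tendsto_even_odd G_even G_odd).congr' ?_
    filter_upwards [eventually_gt_atTop 2] with n hn
    unfold Gfun Rfun
    rw [show 2 * (0 + 1) + 3 * n - 5 = 3 * n - 3 by omega,
      show 2 * (0 + 1) + n - 1 = n + 1 by omega]
  | succ p ih =>
    have hinv := tendsto_inv_atTop_nhds_zero_nat (𝕜 := ℝ)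
    have h2 : Tendsto (fun n : ℕ => (3 + (2 * p - 1) * (n : ℝ)⁻¹) / (1 + (2 * p + 3) * (n : ℝ)⁻¹))
        atTop (𝓝 ((3 + (2 * p - 1) * 0) / (1 + (2 * p + 3) * 0))) :=
      ((hinv.const_mul _).const_add 3).div ((hinv.const_mul _).const_add 1) (by norm_num)
    have h := ih.mul h2
    have e : (3 ^ p * (1 / (12 * √(2 * Real.pi)))) *
        ((3 + (2 * (p : ℝ) - 1) * 0) / (1 + (2 * p + 3) * 0)) =
        3 ^ (p + 1) * (1 / (12 * √(2 * Real.pi))) := by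
      rw [pow_succ]; simp; ring
    rw [e] at h
    refine h.congr' ?_
    filter_upwards [eventually_gt_atTop 2] with n hn
    obtain ⟨m, rfl⟩ : ∃ m, n = m + 2 := ⟨n - 2, by omega⟩
    unfold Rfun
    rw [show 2 * (p + 1 + 1) + 3 * (m + 2) - 5 = (2 * p + 3 * m + 3) + 2 by omega,
      show 2 * (p + 1 + 1) + (m + 2) - 1 = (2 * p + m + 3) + 2 by omega,
      show 2 * (p + 1) + 3 * (m + 2) - 5 = (2 * p + 3 * m + 3) by omega,
      show 2 * (p + 1) + (m + 2) - 1 = (2 * p + m + 3) by omega,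
      Nat.doubleFactorial_add_two (2 * p + 3 * m + 3), Nat.doubleFactorial_add_two (2 * p + m + 3)]
    have hm : (0 : ℝ) < ((m + 2 : ℕ) : ℝ) := by positivity
    have a1 : 3 + (2 * (p : ℝ) - 1) * ((m + 2 : ℕ) : ℝ)⁻¹
        = ((2 * p + 3 * m + 3 + 2 : ℕ) : ℝ) / ((m + 2 : ℕ) : ℝ) := by
      field_simp; push_cast; ring
    have a2 : 1 + (2 * (p : ℝ) + 3) * ((m + 2 : ℕ) : ℝ)⁻¹
        = ((2 * p + m + 3 + 2 : ℕ) : ℝ) / ((m + 2 : ℕ) : ℝ) := by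
      field_simp; push_cast; ring
    rw [a1, a2]
    have b1 : (0 : ℝ) < (2 * p + m + 3 + 2 : ℕ) := by positivity
    have b2 : (0 : ℝ) < Nat.doubleFactorial (2 * p + m + 3) := by
      exact_mod_cast Nat.doubleFactorial_pos _
    rw [Nat.cast_mul, Nat.cast_mul]
    field_simp

/-- For each fixed p ≥ 1, T(n,p) ~ C(p)·(12√3)^n·n^{−5/2} as n → ∞, i.e.
T(n,p)·n^{5/2}·(12√3)^{−n} → C(p). -/
theorem T_asymptotics (p : ℕ) (hp : 1 ≤ p) :
    Filter.Tendsto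
      (fun n : ℕ => Tfun n p * (n : ℝ) ^ (5 / 2 : ℝ) * (12 * Real.sqrt 3) ^ (-(n : ℤ)))
      Filter.atTop (nhds (Cfun p)) := by
  obtain ⟨q, rfl⟩ : ∃ q, p = q + 1 := ⟨p - 1, by omega⟩
  have h := (R_lim q).const_mul
    (((q + 1 : ℕ) : ℝ) * ((2 * (q + 1)).factorial : ℝ) / ((q + 1).factorial : ℝ) ^ 2)
  have e : (((q + 1 : ℕ) : ℝ) * ((2 * (q + 1)).factorial : ℝ) / ((q + 1).factorial : ℝ) ^ 2) *
      (3 ^ q * (1 / (12 * √(2 * Real.pi)))) = Cfun (q + 1) := by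
    unfold Cfun
    have : (3 : ℝ) ^ (((q + 1 : ℕ) : ℤ) - 2) = 3 ^ q / 3 := by
      rw [show ((q + 1 : ℕ) : ℤ) - 2 = (q : ℤ) - 1 by push_cast; ring,
        zpow_sub₀ (by norm_num)]
      simp
    rw [this]
    field_simp
    try norm_num
  rw [e] at h
  refine h.congr' ?_
  filter_upwards [Filter.eventually_gt_atTop 2] with n hn
  have hn' : (0 : ℝ) < n := by exact_mod_cast (by omega : 0 < n)
  have r : (n : ℝ) ^ (5 / 2 : ℝ) = (n : ℝ) ^ 2 * √n := by
    rw [Real.sqrt_eq_rpow, ← Real.rpow_natCast, ← Real.rpow_add hn']; norm_num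
  rw [r, zpow_neg, zpow_natCast]
  unfold Rfun Tfun
  have b2 : (0 : ℝ) < Nat.doubleFactorial (2 * (q + 1) + n - 1) := by
    exact_mod_cast Nat.doubleFactorial_pos _
  field_simp
end

section
/- For every real α > 0 there exists a constant c' > 0 such that, for every integer n ≥ 1 and every integer p with 1 ≤ p ≤ α·√n, one has T(n,p) ≥ c'·C(p)·n^{−5/2}·(12√3)^n. -/
open Nat in
/-- The main factor with shifted indices n = m+1, p = q+1. -/
noncomputable def Aux (m q : ℕ) : ℝ :=
  4 ^ m * ((2 * q + 3 * m)‼ : ℝ) / (((m + 1)! : ℝ) * ((2 * q + m + 2)‼ : ℝ))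

open Nat in
lemma Aux_pos (m q : ℕ) : 0 < Aux m q := by
  have h1 : 0 < (2 * q + 3 * m)‼ := Nat.doubleFactorial_pos _
  have h2 : 0 < (2 * q + m + 2)‼ := Nat.doubleFactorial_pos _
  have h3 : 0 < (m + 1)! := Nat.factorial_pos _
  unfold Aux
  positivity

open Nat in
lemma Aux_succ_q (m q : ℕ) :
    Aux m (q + 1) * (2 * q + m + 4) = Aux m q * (2 * q + 3 * m + 2) := by
  have h1 : (0 : ℝ) < ((2 * q + 3 * m)‼ : ℝ) := by exact_mod_cast Nat.doubleFactorial_pos _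
  have h2 : (0 : ℝ) < ((2 * q + m + 2)‼ : ℝ) := by exact_mod_cast Nat.doubleFactorial_pos _
  have h3 : (0 : ℝ) < ((m + 1)! : ℝ) := by exact_mod_cast Nat.factorial_pos _
  have e1 : (2 * (q + 1) + 3 * m)‼ = (2 * q + 3 * m + 2) * (2 * q + 3 * m)‼ := by
    rw [← Nat.doubleFactorial_add_two]; congr 1; ring
  have e2 : (2 * (q + 1) + m + 2)‼ = (2 * q + m + 4) * (2 * q + m + 2)‼ := by
    rw [show 2 * (q + 1) + m + 2 = (2 * q + m + 2) + 2 by ring, Nat.doubleFactorial_add_two]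
  unfold Aux
  rw [e1, e2]
  push_cast
  field_simp

open Nat in
lemma Aux_two_m (m : ℕ) :
    Aux (m + 2) 0 * ((m + 3) * (m + 4)) = Aux m 0 * (48 * (9 * (m + 1) ^ 2 - 1)) := by
  have h1 : (0 : ℝ) < ((3 * m)‼ : ℝ) := by exact_mod_cast Nat.doubleFactorial_pos _
  have h2 : (0 : ℝ) < ((m + 2)‼ : ℝ) := by exact_mod_cast Nat.doubleFactorial_pos _
  have h3 : (0 : ℝ) < ((m + 1)! : ℝ) := by exact_mod_cast Nat.factorial_pos _
  have e1 : (2 * 0 + 3 * (m + 2))‼ = (3 * m + 6) * ((3 * m + 4) * ((3 * m + 2) * (3 * m)‼)) := by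
    rw [← Nat.doubleFactorial_add_two, ← Nat.doubleFactorial_add_two,
      ← Nat.doubleFactorial_add_two]; congr 1; ring
  have e2 : (2 * 0 + (m + 2) + 2)‼ = (m + 4) * (m + 2)‼ := by
    rw [show 2 * 0 + (m + 2) + 2 = (m + 2) + 2 by ring, Nat.doubleFactorial_add_two]
  have e3 : (m + 2 + 1)! = (m + 3) * ((m + 2) * (m + 1)!) := by
    rw [Nat.factorial_succ, Nat.factorial_succ (m + 1)]
  unfold Aux
  rw [e1, e2, e3]
  simp only [Nat.mul_zero, Nat.zero_add]
  push_cast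
  field_simp
  ring

lemma Aux_base (m : ℕ) : (432 : ℝ) ^ (m + 1) ≤ 1764 * (Aux m 0 ^ 2 * (m + 1) ^ 5) := by
  induction m using Nat.twoStepInduction with
  | zero => norm_num [Aux, Nat.doubleFactorial]
  | one => norm_num [Aux, Nat.doubleFactorial, Nat.factorial]
  | more m ih _ =>
    have hA := Aux_pos m 0
    have e : Aux (m + 2) 0 = Aux m 0 * (48 * (9 * (m + 1) ^ 2 - 1)) / ((m + 3) * (m + 4)) := by
      rw [← Aux_two_m]; field_simp
    have key : 432 ^ 2 * ((m : ℝ) + 1) ^ 5 ≤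
        ((48 * (9 * ((m : ℝ) + 1) ^ 2 - 1)) / ((m + 3) * (m + 4))) ^ 2 * (m + 3) ^ 5 := by
      rw [div_pow, div_mul_eq_mul_div, le_div_iff₀ (by positivity), ← sub_nonneg]
      ring_nf
      positivity
    calc (432 : ℝ) ^ (m + 2 + 1) = 432 ^ 2 * 432 ^ (m + 1) := by ring
      _ ≤ 432 ^ 2 * (1764 * (Aux m 0 ^ 2 * (m + 1) ^ 5)) := by gcongr
      _ = 1764 * Aux m 0 ^ 2 * (432 ^ 2 * ((m : ℝ) + 1) ^ 5) := by ring
      _ ≤ 1764 * Aux m 0 ^ 2 * (((48 * (9 * ((m : ℝ) + 1) ^ 2 - 1)) / ((m + 3) * (m + 4))) ^ 2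
            * (m + 3) ^ 5) := by gcongr
      _ = _ := by rw [e]; push_cast; ring

lemma Aux_q (m q : ℕ) :
    Aux m 0 * 3 ^ q * Real.exp (-(10 * (q + 1) ^ 2 / (m + 1))) ≤ Aux m q := by
  induction q with
  | zero =>
    have hA := Aux_pos m 0
    have : Real.exp (-(10 * (((0 : ℕ) : ℝ) + 1) ^ 2 / (m + 1))) ≤ 1 := by
      rw [Real.exp_le_one_iff, neg_nonpos]; positivity
    rw [pow_zero, mul_one]
    exact mul_le_of_le_one_right hA.le this
  | succ q ih =>
    have hA := Aux_pos m q
    have h0 := Aux_pos m 0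
    have hr : 3 * Real.exp (-(10 * (q + 1) / (m + 1))) * (2 * q + m + 4) ≤ 2 * q + 3 * m + 2 := by
      rw [Real.exp_neg]
      have h := Real.add_one_le_exp (10 * ((q : ℝ) + 1) / (m + 1))
      rw [← div_eq_mul_inv, div_mul_eq_mul_div, div_le_iff₀ (Real.exp_pos _)]
      refine le_trans ?_ (mul_le_mul_of_nonneg_left h (by positivity))
      have : (10 : ℝ) * (q + 1) ≤ (2 * q + 3 * m + 2) * (10 * (q + 1) / (m + 1)) := by
        rw [mul_div_assoc', le_div_iff₀ (by positivity), ← sub_nonneg]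
        ring_nf
        positivity
      nlinarith
    have e : Aux m (q + 1) = Aux m q * (2 * q + 3 * m + 2) / (2 * q + m + 4) := by
      rw [← Aux_succ_q]; field_simp
    rw [e, le_div_iff₀ (by positivity)]
    have hexp : Real.exp (-(10 * (((q + 1 : ℕ) : ℝ) + 1) ^ 2 / (m + 1))) ≤
        Real.exp (-(10 * ((q : ℝ) + 1) ^ 2 / (m + 1))) * Real.exp (-(10 * (q + 1) / (m + 1))) := by
      rw [← Real.exp_add, Real.exp_le_exp, ← neg_add, neg_le_neg_iff, ← add_div]
      gcongr
      push_cast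
      nlinarith
    calc Aux m 0 * 3 ^ (q + 1) * Real.exp (-(10 * (((q + 1 : ℕ) : ℝ) + 1) ^ 2 / (m + 1)))
          * (2 * q + m + 4)
        ≤ Aux m 0 * 3 ^ (q + 1) * (Real.exp (-(10 * ((q : ℝ) + 1) ^ 2 / (m + 1))) *
          Real.exp (-(10 * (q + 1) / (m + 1)))) * (2 * q + m + 4) := by gcongr
      _ = (Aux m 0 * 3 ^ q * Real.exp (-(10 * ((q : ℝ) + 1) ^ 2 / (m + 1)))) *
          (3 * Real.exp (-(10 * (q + 1) / (m + 1))) * (2 * q + m + 4)) := by ring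
      _ ≤ Aux m q * (2 * q + 3 * m + 2) := by gcongr

lemma Aux_base' (m : ℕ) :
    1 / 42 * (((m + 1 : ℕ) : ℝ) ^ (-(5 / 2) : ℝ) * (12 * Real.sqrt 3) ^ (m + 1)) ≤ Aux m 0 := by
  have hA := Aux_pos m 0
  have hb := Aux_base m
  refine (pow_le_pow_iff_left₀ (by positivity) hA.le two_ne_zero).mp ?_
  have e1 : (((m + 1 : ℕ) : ℝ) ^ (-(5 / 2) : ℝ)) ^ 2 = (((m : ℝ) + 1) ^ 5)⁻¹ := by
    rw [← Real.rpow_natCast, ← Real.rpow_mul (by positivity)]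
    rw [show (-(5 / 2) : ℝ) * ((2 : ℕ) : ℝ) = -((5 : ℕ) : ℝ) by norm_num,
      Real.rpow_neg (by positivity), Real.rpow_natCast]
    push_cast; rfl
  have e2 : ((12 * Real.sqrt 3) ^ (m + 1)) ^ 2 = (432 : ℝ) ^ (m + 1) := by
    rw [← pow_mul, mul_comm (m + 1) 2, pow_mul, mul_pow, Real.sq_sqrt (by norm_num)]
    norm_num
  rw [mul_pow, mul_pow, e1, e2]
  have : (((m : ℝ) + 1) ^ 5)⁻¹ * 432 ^ (m + 1) ≤ 1764 * Aux m 0 ^ 2 := by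
    rw [inv_mul_le_iff₀ (by positivity)]
    linarith
  linarith

/-- For every α > 0 there is c' > 0 such that
T(n,p) ≥ c'·C(p)·n^{−5/2}·(12√3)^n for all n ≥ 1 and 1 ≤ p ≤ α·√n. -/
theorem T_lower_bound (α : ℝ) (hα : 0 < α) :
    ∃ c' : ℝ, 0 < c' ∧ ∀ n p : ℕ, 1 ≤ n → 1 ≤ p → (p : ℝ) ≤ α * Real.sqrt n →
      c' * Cfun p * (n : ℝ) ^ (-(5 / 2) : ℝ) * (12 * Real.sqrt 3) ^ n ≤ Tfun n p := by
  refine ⟨Real.exp (-(10 * α ^ 2)) * (1 / 42), by positivity, ?_⟩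
  intro n p hn hp h
  obtain ⟨m, rfl⟩ : ∃ m, n = m + 1 := ⟨n - 1, by omega⟩
  obtain ⟨q, rfl⟩ : ∃ q, p = q + 1 := ⟨p - 1, by omega⟩
  have hf : (0 : ℝ) < (Nat.factorial (q + 1) : ℝ) := by exact_mod_cast Nat.factorial_pos _
  set B : ℝ := ((q + 1 : ℕ) : ℝ) * (Nat.factorial (2 * (q + 1)) : ℝ) /
    (Nat.factorial (q + 1) : ℝ) ^ 2 with hB
  have hB0 : 0 ≤ B := by positivity
  have hT : Tfun (m + 1) (q + 1) = B * Aux m q := by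
    unfold Tfun Aux
    rw [hB, show 2 * (q + 1) + 3 * (m + 1) - 5 = 2 * q + 3 * m by omega,
      show 2 * (q + 1) + (m + 1) - 1 = 2 * q + m + 2 by omega, Nat.add_sub_cancel,
      div_mul_div_comm]
    congr 1 <;> ring
  have hC : Cfun (q + 1) ≤ B * 3 ^ q := by
    have hz : (3 : ℝ) ^ (((q + 1 : ℕ) : ℤ) - 2) ≤ 3 ^ q := by
      rw [← zpow_natCast]
      apply zpow_le_zpow_right₀ (by norm_num)
      push_cast; omega
    have hs : 1 ≤ 4 * Real.sqrt (2 * Real.pi) := by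
      have : 1 ≤ Real.sqrt (2 * Real.pi) := by
        rw [Real.one_le_sqrt]; linarith [Real.pi_gt_three]
      linarith
    have : Cfun (q + 1) = B * (3 : ℝ) ^ (((q + 1 : ℕ) : ℤ) - 2) / (4 * Real.sqrt (2 * Real.pi)) := by
      unfold Cfun
      rw [hB]
      field_simp
    rw [this]
    refine (div_le_self (by positivity) hs).trans ?_
    gcongr
  have hexp : Real.exp (-(10 * α ^ 2)) ≤ Real.exp (-(10 * ((q : ℝ) + 1) ^ 2 / (m + 1))) := by
    rw [Real.exp_le_exp, neg_le_neg_iff, div_le_iff₀ (by positivity)]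
    have h2 := pow_le_pow_left₀ (by positivity) h 2
    rw [mul_pow, Real.sq_sqrt (by positivity)] at h2
    push_cast at h2
    linarith
  have hq := Aux_q m q
  have hb := Aux_base' m
  rw [hT]
  set X : ℝ := ((m + 1 : ℕ) : ℝ) ^ (-(5 / 2) : ℝ) * (12 * Real.sqrt 3) ^ (m + 1) with hX
  have hX0 : 0 ≤ X := by positivity
  have hA0 := Aux_pos m 0
  calc Real.exp (-(10 * α ^ 2)) * (1 / 42) * Cfun (q + 1) * ((m + 1 : ℕ) : ℝ) ^ (-(5 / 2) : ℝ) *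
        (12 * Real.sqrt 3) ^ (m + 1)
      = Cfun (q + 1) * (Real.exp (-(10 * α ^ 2)) * (1 / 42 * X)) := by rw [hX]; ring
    _ ≤ (B * 3 ^ q) * (Real.exp (-(10 * ((q : ℝ) + 1) ^ 2 / (m + 1))) * Aux m 0) := by
        gcongr
    _ = B * (Aux m 0 * 3 ^ q * Real.exp (-(10 * ((q : ℝ) + 1) ^ 2 / (m + 1)))) := by ring
    _ ≤ B * Aux m q := by gcongr
end
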